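/- Let R = ℂ⟦x,y⟧ with maximal ideal m = ⟨x,y⟩. Let I be an ideal of R generated by two elements with x² ∈ I, xy² ∈ I, y³ ∈ I and dim_ℂ(R/I) ≥ 3. Then either there exist u, v ∈ R with ⟨u,v⟩ = m and I = ⟨u², v²⟩ (in which case dim_ℂ(R/I) = 4), or there exist u, v ∈ R with ⟨u,v⟩ = m and I = ⟨u, v³⟩ (in which case dim_ℂ(R/I) = 3). -/

import Mathlib

/-- The formal power series ring `R = ℂ⟦x,y⟧`. -/
noncomputable abbrev R2 : Type := MvPowerSeries (Fin 2) ℂ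

/-- The variable `x`. -/
noncomputable def Xv : R2 := MvPowerSeries.X 0

/-- The variable `y`. -/
noncomputable def Yv : R2 := MvPowerSeries.X 1

/-- The maximal ideal `m = ⟨x, y⟩` of `R = ℂ⟦x,y⟧`. -/
noncomputable def mIdeal : Ideal R2 := Ideal.span {Xv, Yv}

/-- The coefficient of `x^i y^j` as a linear functional. -/
noncomputable def eco (i j : ℕ) : R2 →ₗ[ℂ] ℂ :=
  MvPowerSeries.coeff (Finsupp.single 0 i + Finsupp.single 1 j)

lemma eco_X_succ (i j : ℕ) (g : R2) : eco (i + 1) j (Xv * g) = eco i j g := by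
  unfold eco Xv
  have h : (Finsupp.single 0 (i + 1) + Finsupp.single 1 j : Fin 2 →₀ ℕ)
      = Finsupp.single 0 1 + (Finsupp.single 0 i + Finsupp.single 1 j) := by
    rw [add_comm i 1, Finsupp.single_add, add_assoc]
  rw [h, MvPowerSeries.X, MvPowerSeries.coeff_add_monomial_mul, one_mul]

lemma eco_X_zero (j : ℕ) (g : R2) : eco 0 j (Xv * g) = 0 := by
  have h : (MvPowerSeries.X 0 : R2) ∣ Xv * g := Dvd.intro _ rfl
  exact MvPowerSeries.X_dvd_iff.1 h _ (by simp)

lemma eco_Y_succ (i j : ℕ) (g : R2) : eco i (j + 1) (Yv * g) = eco i j g := by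
  unfold eco Yv
  have h : (Finsupp.single 0 i + Finsupp.single 1 (j + 1) : Fin 2 →₀ ℕ)
      = Finsupp.single 1 1 + (Finsupp.single 0 i + Finsupp.single 1 j) := by
    rw [add_comm j 1, Finsupp.single_add, add_left_comm]
  rw [h, MvPowerSeries.X, MvPowerSeries.coeff_add_monomial_mul, one_mul]

lemma eco_Y_zero (i : ℕ) (g : R2) : eco i 0 (Yv * g) = 0 := by
  have h : (MvPowerSeries.X 1 : R2) ∣ Yv * g := Dvd.intro _ rfl
  exact MvPowerSeries.X_dvd_iff.1 h _ (by simp)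

lemma eco_C_mul (i j : ℕ) (c : ℂ) (g : R2) :
    eco i j (MvPowerSeries.C c * g) = c * eco i j g := by
  unfold eco; rw [MvPowerSeries.coeff_C_mul]

lemma eco_one_zero : eco 0 0 (1 : R2) = 1 := by
  unfold eco; simp

lemma eco_one_left (i j : ℕ) : eco (i + 1) j (1 : R2) = 0 := by
  unfold eco; rw [MvPowerSeries.coeff_one, if_neg]
  intro h; have := DFunLike.congr_fun h 0; simp at this

lemma eco_one_right (i j : ℕ) : eco i (j + 1) (1 : R2) = 0 := by
  unfold eco; rw [MvPowerSeries.coeff_one, if_neg]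
  intro h; have := DFunLike.congr_fun h 1; simp at this

lemma decomp1 (f : R2) : ∃ a b : R2,
    f = MvPowerSeries.C (eco 0 0 f) * 1 + Xv * a + Yv * b := by
  classical
  let p : R2 := fun n => if n 0 = 0 then MvPowerSeries.coeff n f else 0
  have hp : ∀ n, MvPowerSeries.coeff n p = if n 0 = 0 then MvPowerSeries.coeff n f else 0 :=
    fun n => rfl
  have h1 : (MvPowerSeries.X 0 : R2) ∣ f - p := by
    rw [MvPowerSeries.X_dvd_iff]
    intro m hm
    rw [map_sub, hp, if_pos hm, sub_self]
  have h2 : (MvPowerSeries.X 1 : R2) ∣ p - MvPowerSeries.C (eco 0 0 f) := by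
    rw [MvPowerSeries.X_dvd_iff]
    intro m hm
    rw [map_sub, hp, MvPowerSeries.coeff_C]
    by_cases h0 : m 0 = 0
    · have : m = 0 := by
        ext i; fin_cases i <;> simp [h0, hm]
      subst this
      simp [eco]
    · have : m ≠ 0 := by
        rintro rfl; simp at h0
      simp [h0, this]
  obtain ⟨a, ha⟩ := h1
  obtain ⟨b, hb⟩ := h2
  refine ⟨a, b, ?_⟩
  unfold Xv Yv
  rw [← ha, ← hb]; ring

/-- Decomposition modulo `(x², xy², y³)`. -/
lemma decomp (f : R2) : ∃ a b c : R2,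
    f = MvPowerSeries.C (eco 0 0 f) + MvPowerSeries.C (eco 1 0 f) * Xv
      + MvPowerSeries.C (eco 0 1 f) * Yv + MvPowerSeries.C (eco 1 1 f) * (Xv * Yv)
      + MvPowerSeries.C (eco 0 2 f) * Yv ^ 2
      + (a * Xv ^ 2 + b * (Xv * Yv ^ 2) + c * Yv ^ 3) := by
  obtain ⟨a, b, h⟩ := decomp1 f
  obtain ⟨a1, a2, ha⟩ := decomp1 a
  obtain ⟨b1, b2, hb⟩ := decomp1 b
  obtain ⟨c1, c2, hc⟩ := decomp1 a2
  obtain ⟨d1, d2, hd⟩ := decomp1 b1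
  obtain ⟨k1, k2, hk⟩ := decomp1 b2
  have e10 : eco 1 0 f = eco 0 0 a := by
    conv_lhs => rw [h]
    simp [-mul_one, map_add, eco_C_mul, eco_X_succ, eco_Y_zero, eco_one_left]
  have e01 : eco 0 1 f = eco 0 0 b := by
    conv_lhs => rw [h]
    simp [-mul_one, map_add, eco_C_mul, eco_X_zero, eco_Y_succ, eco_one_right]
  have e02 : eco 0 2 f = eco 0 0 b2 := by
    conv_lhs => rw [h, hb]
    simp [-mul_one, map_add, mul_add, eco_C_mul, eco_X_zero, eco_Y_succ, eco_one_right]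
  have e11 : eco 1 1 f = eco 0 0 a2 + eco 0 0 b1 := by
    conv_lhs => rw [h, hb, ha]
    simp [-mul_one, map_add, mul_add, eco_C_mul, eco_X_zero, eco_Y_succ, eco_X_succ, eco_Y_zero,
      eco_one_right, eco_one_left]
  refine ⟨a1 + Yv * c1 + Yv * d1, c2 + d2 + k1, k2, ?_⟩
  rw [e10, e01, e02, e11, map_add]
  linear_combination h + Xv * ha + Yv * hb + Xv * Yv * hc + Xv * Yv * hd + Yv ^ 2 * hk

lemma three_gen (I : Ideal R2) (hgen : ∃ g h : R2, I = Ideal.span {g, h})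
    (L : Fin 3 → (R2 →ₗ[ℂ] ℂ))
    (hX : ∀ i, ∀ g ∈ I, L i (Xv * g) = 0) (hY : ∀ i, ∀ g ∈ I, L i (Yv * g) = 0)
    (p : Fin 3 → R2) (hp : ∀ j, p j ∈ I) :
    (Matrix.of fun i j => L i (p j)).det = 0 := by
  obtain ⟨g, h, rfl⟩ := hgen
  have hg : g ∈ Ideal.span {g, h} := Ideal.subset_span (by simp)
  have hh : h ∈ Ideal.span {g, h} := Ideal.subset_span (by simp)
  have key : ∀ i, ∀ r : R2, ∀ f ∈ Ideal.span {g, h}, L i (r * f) = eco 0 0 r * L i f := by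
    intro i r f hf
    obtain ⟨a, b, hr⟩ := decomp1 r
    have : r * f = (eco 0 0 r) • f + Xv * (a * f) + Yv * (b * f) := by
      rw [MvPowerSeries.smul_eq_C_mul]
      linear_combination f * hr
    rw [this, map_add, map_add, hX i _ (Ideal.mul_mem_left _ _ hf),
      hY i _ (Ideal.mul_mem_left _ _ hf), map_smul]
    simp
  have h2 : ∀ j, ∃ r s : ℂ, ∀ i, L i (p j) = r * L i g + s * L i h := by
    intro j
    obtain ⟨r, s, hrs⟩ := Ideal.mem_span_pair.1 (hp j)
    refine ⟨eco 0 0 r, eco 0 0 s, fun i => ?_⟩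
    rw [← hrs, map_add, key i _ _ hg, key i _ _ hh]
  choose r s hrs using h2
  rw [Matrix.det_fin_three]
  simp only [Matrix.of_apply, hrs]
  ring

/-- Linear map from coefficients. -/
noncomputable def psi (I : Ideal R2) {n : ℕ} (b : Fin n → R2) : (Fin n → ℂ) →ₗ[ℂ] (R2 ⧸ I) :=
  Fintype.linearCombination ℂ (fun i => Ideal.Quotient.mk I (b i))

lemma psi_apply (I : Ideal R2) {n : ℕ} (b : Fin n → R2) (c : Fin n → ℂ) :
    psi I b c = Ideal.Quotient.mk I (∑ i, MvPowerSeries.C (c i) * b i) := by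
  unfold psi
  rw [Fintype.linearCombination_apply, map_sum]
  refine Finset.sum_congr rfl fun i _ => ?_
  rw [← MvPowerSeries.smul_eq_C_mul]
  rfl

lemma psi_surj (I : Ideal R2) {n : ℕ} (b : Fin n → R2)
    (h : ∀ f : R2, ∃ c : Fin n → ℂ, f - ∑ i, MvPowerSeries.C (c i) * b i ∈ I) :
    Function.Surjective (psi I b) := by
  intro q
  obtain ⟨f, rfl⟩ := Ideal.Quotient.mk_surjective q
  obtain ⟨c, hc⟩ := h f
  exact ⟨c, by rw [psi_apply]; exact (Ideal.Quotient.eq.2 hc).symm⟩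

lemma psi_rank_le (I : Ideal R2) {n : ℕ} (b : Fin n → R2)
    (h : Function.Surjective (psi I b)) : Module.rank ℂ (R2 ⧸ I) ≤ n := by
  have := LinearMap.rank_le_of_surjective _ h
  simpa using this

/-- Let `I` be an ideal of `R = ℂ⟦x,y⟧` generated by two elements with
`x² ∈ I`, `xy² ∈ I`, `y³ ∈ I` and `dim_ℂ(R/I) ≥ 3`. Then either there is a
regular system of parameters `u, v` with `I = ⟨u², v²⟩` (in which case
`dim_ℂ(R/I) = 4`), or one with `I = ⟨u, v³⟩` (in which case `dim_ℂ(R/I) = 3`). -/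
theorem stmt1 (I : Ideal R2) (hgen : ∃ g h : R2, I = Ideal.span {g, h})
    (hx2 : Xv ^ 2 ∈ I) (hxy2 : Xv * Yv ^ 2 ∈ I) (hy3 : Yv ^ 3 ∈ I)
    (hdim : (3 : Cardinal) ≤ Module.rank ℂ (R2 ⧸ I)) :
    (∃ u v : R2, Ideal.span {u, v} = mIdeal ∧ I = Ideal.span {u ^ 2, v ^ 2} ∧
        Module.rank ℂ (R2 ⧸ I) = 4) ∨
    (∃ u v : R2, Ideal.span {u, v} = mIdeal ∧ I = Ideal.span {u, v ^ 3} ∧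
        Module.rank ℂ (R2 ⧸ I) = 3) := by
  have hJ : ∀ a b c : R2, a * Xv ^ 2 + b * (Xv * Yv ^ 2) + c * Yv ^ 3 ∈ I := fun a b c =>
    add_mem (add_mem (I.mul_mem_left _ hx2) (I.mul_mem_left _ hxy2)) (I.mul_mem_left _ hy3)
  have hC : ∀ {c : ℂ} {f : R2}, c ≠ 0 → MvPowerSeries.C c * f ∈ I → f ∈ I := by
    intro c f hc hf
    have := I.mul_mem_left (MvPowerSeries.C c⁻¹) hf
    rwa [← mul_assoc, ← map_mul, inv_mul_cancel₀ hc, map_one, one_mul] at this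
  -- I is inside m
  have h00 : ∀ f ∈ I, eco 0 0 f = 0 := by
    intro f hf
    by_contra hne
    have hu : IsUnit f := by
      rw [MvPowerSeries.isUnit_iff_constantCoeff, isUnit_iff_ne_zero]
      simpa [eco] using hne
    have hs := psi_rank_le I (n := 0) (fun _ => 0) (psi_surj I _ fun f' => ⟨0, by
      rw [Ideal.eq_top_of_isUnit_mem I hf hu]; trivial⟩)
    have := hdim.trans hs
    norm_num at this
  have h01 : ∀ f ∈ I, eco 0 1 f = 0 := by
    intro f hf
    by_contra hne
    obtain ⟨a, b, c, hd⟩ := decomp f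
    rw [h00 f hf, map_zero] at hd
    have hxy : Xv * Yv ∈ I := by
      refine hC hne ?_
      have : MvPowerSeries.C (eco 0 1 f) * (Xv * Yv) = Xv * f
          - (MvPowerSeries.C (eco 1 0 f) + MvPowerSeries.C (eco 1 1 f) * Yv + a * Xv
             + b * Yv ^ 2) * Xv ^ 2
          - (MvPowerSeries.C (eco 0 2 f) + c * Yv) * (Xv * Yv ^ 2) := by
        linear_combination -Xv * hd
      rw [this]
      exact sub_mem (sub_mem (I.mul_mem_left _ hf) (I.mul_mem_left _ hx2)) (I.mul_mem_left _ hxy2)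
    have hy2 : Yv ^ 2 ∈ I := by
      refine hC hne ?_
      have : MvPowerSeries.C (eco 0 1 f) * Yv ^ 2 = Yv * f
          - (MvPowerSeries.C (eco 1 0 f) + MvPowerSeries.C (eco 1 1 f) * Yv + a * Xv
             + b * Yv ^ 2) * (Xv * Yv)
          - (MvPowerSeries.C (eco 0 2 f) + c * Yv) * Yv ^ 3 := by
        linear_combination -Yv * hd
      rw [this]
      exact sub_mem (sub_mem (I.mul_mem_left _ hf) (I.mul_mem_left _ hxy)) (I.mul_mem_left _ hy3)
    have hy : Yv + MvPowerSeries.C (eco 1 0 f / eco 0 1 f) * Xv ∈ I := by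
      refine hC hne ?_
      have e : MvPowerSeries.C (eco 0 1 f) * MvPowerSeries.C (eco 1 0 f / eco 0 1 f)
          = (MvPowerSeries.C (eco 1 0 f) : R2) := by
        rw [← map_mul, mul_div_cancel₀ _ hne]
      have : MvPowerSeries.C (eco 0 1 f) * (Yv + MvPowerSeries.C (eco 1 0 f / eco 0 1 f) * Xv)
         = f - MvPowerSeries.C (eco 1 1 f) * (Xv * Yv) - MvPowerSeries.C (eco 0 2 f) * Yv ^ 2
          - (a * Xv ^ 2 + b * (Xv * Yv ^ 2) + c * Yv ^ 3) := by
        linear_combination -hd + Xv * e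
      rw [this]
      exact sub_mem (sub_mem (sub_mem hf (I.mul_mem_left _ hxy)) (I.mul_mem_left _ hy2)) (hJ _ _ _)
    have hs := psi_rank_le I (n := 2) ![1, Xv] (psi_surj I _ fun f' => by
      obtain ⟨a', b', c', hd'⟩ := decomp f'
      refine ⟨![eco 0 0 f', eco 1 0 f' - eco 0 1 f' * (eco 1 0 f / eco 0 1 f)], ?_⟩
      have : f' - ∑ i, MvPowerSeries.C ((![eco 0 0 f', eco 1 0 f' - eco 0 1 f' * (eco 1 0 f / eco 0 1 f)] : Fin 2 → ℂ) i) * (![1, Xv] : Fin 2 → R2) i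
          = MvPowerSeries.C (eco 0 1 f') * (Yv + MvPowerSeries.C (eco 1 0 f / eco 0 1 f) * Xv)
           + MvPowerSeries.C (eco 1 1 f') * (Xv * Yv) + MvPowerSeries.C (eco 0 2 f') * Yv ^ 2
          + (a' * Xv ^ 2 + b' * (Xv * Yv ^ 2) + c' * Yv ^ 3) := by
        simp only [Fin.sum_univ_two, Matrix.cons_val_zero, Matrix.cons_val_one, map_sub, map_mul]
        linear_combination hd'
      rw [this]
      exact add_mem (add_mem (add_mem (I.mul_mem_left _ hy) (I.mul_mem_left _ hxy))
        (I.mul_mem_left _ hy2)) (hJ _ _ _))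
    have := hdim.trans hs
    norm_num at this
  by_cases h10 : ∀ f ∈ I, eco 1 0 f = 0
  · left
    have hX20 : ∀ g ∈ I, eco 2 0 (Xv * g) = 0 := fun g hg => by rw [eco_X_succ, h10 g hg]
    have hY20 : ∀ g ∈ I, eco 2 0 (Yv * g) = 0 := fun g hg => eco_Y_zero _ _
    have hX11 : ∀ g ∈ I, eco 1 1 (Xv * g) = 0 := fun g hg => by rw [eco_X_succ, h01 g hg]
    have hY11 : ∀ g ∈ I, eco 1 1 (Yv * g) = 0 := fun g hg => by rw [eco_Y_succ, h10 g hg]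
    have hX02 : ∀ g ∈ I, eco 0 2 (Xv * g) = 0 := fun g hg => eco_X_zero _ _
    have hY02 : ∀ g ∈ I, eco 0 2 (Yv * g) = 0 := fun g hg => by rw [eco_Y_succ, h01 g hg]
    have hX03 : ∀ g ∈ I, eco 0 3 (Xv * g) = 0 := fun g hg => eco_X_zero _ _
    have ex : Xv ^ 2 = Xv * (Xv * 1) := by ring
    have ey : Yv ^ 3 = Yv * (Yv * (Yv * 1)) := by ring
    have exy : Xv * Yv ^ 2 = Xv * (Yv * (Yv * 1)) := by ring
    have hex : ∃ f ∈ I, eco 0 2 f ≠ 0 := by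
      by_contra! hno
      have hY03 : ∀ g ∈ I, eco 0 3 (Yv * g) = 0 := fun g hg => by rw [eco_Y_succ, hno g hg]
      by_cases h11 : ∀ f ∈ I, eco 1 1 f = 0
      · have hX12 : ∀ g ∈ I, eco 1 2 (Xv * g) = 0 := fun g hg => by rw [eco_X_succ, hno g hg]
        have hY12 : ∀ g ∈ I, eco 1 2 (Yv * g) = 0 := fun g hg => by rw [eco_Y_succ, h11 g hg]
        have := three_gen I hgen ![eco 2 0, eco 1 2, eco 0 3]
          (by intro i; fin_cases i <;> assumption) (by intro i; fin_cases i <;> assumption)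
          ![Xv ^ 2, Xv * Yv ^ 2, Yv ^ 3] (by intro i; fin_cases i <;> assumption)
        rw [ex, exy, ey, Matrix.det_fin_three] at this
        simp [-mul_one, eco_X_succ, eco_X_zero, eco_Y_succ, eco_Y_zero, eco_one_zero] at this
      · push Not at h11
        obtain ⟨f, hf, hne⟩ := h11
        have := three_gen I hgen ![eco 2 0, eco 1 1, eco 0 3]
          (by intro i; fin_cases i <;> assumption) (by intro i; fin_cases i <;> assumption)
          ![Xv ^ 2, f, Yv ^ 3] (by intro i; fin_cases i <;> assumption)
        rw [ex, ey, Matrix.det_fin_three] at this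
        simp [-mul_one, eco_X_succ, eco_X_zero, eco_Y_succ, eco_Y_zero, eco_one_zero, eco_one_right, hne] at this
    obtain ⟨f, hf, hne⟩ := hex
    have hprop : ∀ g ∈ I, eco 1 1 g * eco 0 2 f = eco 0 2 g * eco 1 1 f := by
      intro g hg
      have := three_gen I hgen ![eco 2 0, eco 1 1, eco 0 2]
          (by intro i; fin_cases i <;> assumption) (by intro i; fin_cases i <;> assumption)
          ![Xv ^ 2, g, f] (by intro i; fin_cases i <;> assumption)
      rw [ex, Matrix.det_fin_three] at this
      simp [-mul_one, eco_X_succ, eco_X_zero, eco_one_zero, eco_one_right] at this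
      linear_combination this
    set α : ℂ := eco 1 1 f / eco 0 2 f with hα
    have hprop' : ∀ g ∈ I, eco 1 1 g = eco 0 2 g * α := by
      intro g hg
      rw [hα, mul_div_assoc', eq_div_iff hne, hprop g hg]
    have hq : Yv ^ 2 + MvPowerSeries.C α * (Xv * Yv) ∈ I := by
      refine hC hne ?_
      obtain ⟨a, b, c, hd⟩ := decomp f
      rw [h00 f hf, h10 f hf, h01 f hf, hprop' f hf, map_zero, map_mul] at hd
      have : MvPowerSeries.C (eco 0 2 f) * (Yv ^ 2 + MvPowerSeries.C α * (Xv * Yv))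
          = f - (a * Xv ^ 2 + b * (Xv * Yv ^ 2) + c * Yv ^ 3) := by
        linear_combination -hd
      rw [this]
      exact sub_mem hf (hJ _ _ _)
    have hC2 : (MvPowerSeries.C α : R2) = 2 * MvPowerSeries.C (α / 2) := by
      rw [show (2 : R2) = MvPowerSeries.C (2 : ℂ) from (map_ofNat _ 2).symm, ← map_mul]
      congr 1; ring
    refine ⟨Xv, Yv + MvPowerSeries.C (α / 2) * Xv, ?_, ?_, ?_⟩
    · unfold mIdeal
      apply le_antisymm <;> rw [Ideal.span_le]
      · rintro z (rfl | rfl)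
        · exact Ideal.subset_span (by simp)
        · exact Ideal.mem_span_pair.2 ⟨MvPowerSeries.C (α / 2), 1, by ring⟩
      · rintro z (rfl | rfl)
        · exact Ideal.subset_span (by simp)
        · exact Ideal.mem_span_pair.2 ⟨-MvPowerSeries.C (α / 2), 1, by ring⟩
    · apply le_antisymm
      · intro g hg
        obtain ⟨a, b, c, hd⟩ := decomp g
        rw [h00 g hg, h10 g hg, h01 g hg, hprop' g hg, map_zero, map_mul, hC2] at hd
        generalize (MvPowerSeries.C (α / 2) : R2) = β at *
        generalize (MvPowerSeries.C (eco 0 2 g) : R2) = δ at *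
        -- with `v = y + β x`: `y² = v² - 2β x y - β² x²`
        refine Ideal.mem_span_pair.2
          ⟨-δ * β ^ 2 + a - b * (β ^ 2 * Xv + 2 * β * Yv)
            - c * (β ^ 2 * Yv) + 2 * β * c * (β ^ 2 * Xv + 2 * β * Yv),
            δ + b * Xv + c * Yv - 2 * β * c * Xv, ?_⟩
        linear_combination -hd
      · rw [Ideal.span_le]
        rintro z (rfl | rfl)
        · exact hx2
        · have : (Yv + MvPowerSeries.C (α / 2) * Xv) ^ 2
            = (Yv ^ 2 + MvPowerSeries.C α * (Xv * Yv)) + MvPowerSeries.C (α / 2) ^ 2 * Xv ^ 2 := by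
            rw [hC2]; ring
          rw [this]
          exact add_mem hq (I.mul_mem_left _ hx2)
    · have hsurj : Function.Surjective (psi I ![1, Xv, Yv, Xv * Yv]) := by
        refine psi_surj I _ fun g => ?_
        obtain ⟨a, b, c, hd⟩ := decomp g
        refine ⟨![eco 0 0 g, eco 1 0 g, eco 0 1 g, eco 1 1 g - eco 0 2 g * α], ?_⟩
        have : g - ∑ i, MvPowerSeries.C ((![eco 0 0 g, eco 1 0 g, eco 0 1 g, eco 1 1 g - eco 0 2 g * α] : Fin 4 → ℂ) i) * (![1, Xv, Yv, Xv * Yv] : Fin 4 → R2) i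
          = MvPowerSeries.C (eco 0 2 g) * (Yv ^ 2 + MvPowerSeries.C α * (Xv * Yv))
            + (a * Xv ^ 2 + b * (Xv * Yv ^ 2) + c * Yv ^ 3) := by
          simp [Fin.sum_univ_four]
          linear_combination hd
        rw [this]
        exact add_mem (I.mul_mem_left _ hq) (hJ _ _ _)
      have hinj : Function.Injective (psi I ![1, Xv, Yv, Xv * Yv]) := by
        rw [← LinearMap.ker_eq_bot, LinearMap.ker_eq_bot']
        intro m hm
        rw [psi_apply, Ideal.Quotient.eq_zero_iff_mem] at hm
        have e1 : Xv * Yv = Xv * (Yv * 1) := by ring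
        have e2 : Xv = Xv * 1 := by ring
        have e3 : Yv = Yv * 1 := by ring
        have hm' : MvPowerSeries.C (m 0) * 1 + MvPowerSeries.C (m 1) * (Xv * 1)
          + MvPowerSeries.C (m 2) * (Yv * 1) + MvPowerSeries.C (m 3) * (Xv * (Yv * 1)) ∈ I := by
          rw [← e1, ← e2, ← e3]
          simpa [Fin.sum_univ_four] using hm
        have k0 := h00 _ hm'
        have k1 := h10 _ hm'
        have k2 := h01 _ hm'
        have k3 := hprop' _ hm'
        simp only [map_add, eco_C_mul, eco_X_succ, eco_X_zero, eco_Y_succ, eco_Y_zero,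
          eco_one_zero, eco_one_left, eco_one_right, eco_X_succ 0, eco_Y_succ _ 0, eco_Y_succ _ 1] at k0 k1 k2 k3
        ext i
        fin_cases i
        · simpa using k0
        · simpa using k1
        · simpa using k2
        · simpa using k3
      have := (LinearEquiv.ofBijective _ ⟨hinj, hsurj⟩).rank_eq
      rw [← this]
      simp
  · right
    push Not at h10
    obtain ⟨f, hf, hne⟩ := h10
    obtain ⟨a, b, c, hd⟩ := decomp f
    rw [h00 f hf, h01 f hf, map_zero] at hd
    have hxy : Xv * Yv ∈ I := by
      refine hC hne ?_
      have : MvPowerSeries.C (eco 1 0 f) * (Xv * Yv) = Yv * f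
          - (a * Yv) * Xv ^ 2
          - (MvPowerSeries.C (eco 1 1 f) + b * Yv) * (Xv * Yv ^ 2)
          - (MvPowerSeries.C (eco 0 2 f) + c * Yv) * Yv ^ 3 := by
        linear_combination -Yv * hd
      rw [this]
      exact sub_mem (sub_mem (sub_mem (I.mul_mem_left _ hf) (I.mul_mem_left _ hx2))
        (I.mul_mem_left _ hxy2)) (I.mul_mem_left _ hy3)
    set d : ℂ := eco 0 2 f / eco 1 0 f with hdd
    have hu : Xv + MvPowerSeries.C d * Yv ^ 2 ∈ I := by
      refine hC hne ?_
      have e : MvPowerSeries.C (eco 1 0 f) * MvPowerSeries.C d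
          = (MvPowerSeries.C (eco 0 2 f) : R2) := by
        rw [← map_mul, hdd, mul_div_cancel₀ _ hne]
      have : MvPowerSeries.C (eco 1 0 f) * (Xv + MvPowerSeries.C d * Yv ^ 2)
         = f - MvPowerSeries.C (eco 1 1 f) * (Xv * Yv)
          - (a * Xv ^ 2 + b * (Xv * Yv ^ 2) + c * Yv ^ 3) := by
        linear_combination -hd + Yv ^ 2 * e
      rw [this]
      exact sub_mem (sub_mem hf (I.mul_mem_left _ hxy)) (hJ _ _ _)
    have hKI : Ideal.span {Xv + MvPowerSeries.C d * Yv ^ 2, Yv ^ 3} ≤ I := by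
      rw [Ideal.span_le]
      rintro z (rfl | rfl)
      · exact hu
      · exact hy3
    have hK : ∀ g : R2, g - ∑ i, MvPowerSeries.C ((![eco 0 0 g, eco 0 1 g, eco 0 2 g - eco 1 0 g * d] : Fin 3 → ℂ) i) * (![1, Yv, Yv ^ 2] : Fin 3 → R2) i ∈ Ideal.span {Xv + MvPowerSeries.C d * Yv ^ 2, Yv ^ 3} := by
      intro g
      obtain ⟨a, b, c, hd⟩ := decomp g
      simp only [Fin.sum_univ_three, Matrix.cons_val, map_sub, map_mul]
      generalize (MvPowerSeries.C d : R2) = D at *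
      refine Ideal.mem_span_pair.2
        ⟨MvPowerSeries.C (eco 1 0 g) + MvPowerSeries.C (eco 1 1 g) * Yv
          + a * (Xv - D * Yv ^ 2) + b * Yv ^ 2,
         c - MvPowerSeries.C (eco 1 1 g) * D + a * D ^ 2 * Yv - b * D * Yv, ?_⟩
      linear_combination -hd
    have hsurj : Function.Surjective (psi I ![1, Yv, Yv ^ 2]) :=
      psi_surj I _ fun g => ⟨_, hKI (hK g)⟩
    have hrank : Module.rank ℂ (R2 ⧸ I) = 3 :=
      le_antisymm (by simpa using psi_rank_le I _ hsurj) hdim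
    have hfin : Module.Finite ℂ (R2 ⧸ I) := Module.Finite.of_surjective _ hsurj
    have hinj : Function.Injective (psi I ![1, Yv, Yv ^ 2]) := by
      refine (LinearMap.injective_iff_surjective_of_finrank_eq_finrank ?_).2 hsurj
      have h3 : Module.finrank ℂ (R2 ⧸ I) = 3 :=
        Module.finrank_eq_of_rank_eq (by rw [hrank]; norm_num)
      rw [h3]
      simp
    refine ⟨Xv + MvPowerSeries.C d * Yv ^ 2, Yv, ?_, ?_, hrank⟩
    · unfold mIdeal
      apply le_antisymm <;> rw [Ideal.span_le]
      · rintro z (rfl | rfl)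
        · exact Ideal.mem_span_pair.2 ⟨1, MvPowerSeries.C d * Yv, by ring⟩
        · exact Ideal.subset_span (by simp)
      · rintro z (rfl | rfl)
        · exact Ideal.mem_span_pair.2 ⟨1, -MvPowerSeries.C d * Yv, by ring⟩
        · exact Ideal.subset_span (by simp)
    · refine le_antisymm (fun g hg => ?_) hKI
      have h1 := hK g
      have h2 := hKI h1
      have h3 := (Ideal.Quotient.eq.2 h2)
      rw [← psi_apply, Ideal.Quotient.eq_zero_iff_mem.2 hg] at h3
      have h4 := hinj (h3.symm.trans (map_zero _).symm)
      rw [h4] at h1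
      simpa using h1
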